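/- Let σ : F → F be a field automorphism of finite order m and let θ : L → L be an extension of σ, i.e., L/F is a finite field extension, the restriction of θ to F equals σ, and L^θ = F^σ. Let T_1, T_2 ⊆ ℤ have the same elements modulo m, i.e., T_1 + mℤ = T_2 + mℤ. Then for every n and every h ∈ L^n whose entries are linearly independent over L^θ, the subfield subcodes C_(θ,h,T_1) ∩ F^n and C_(θ,h,T_2) ∩ F^n are equal. -/

import Mathlib

/-- The fixed subfield of a field automorphism `σ : F ≃+* F`. -/
def fixedField {F : Type*} [Field F] (σ : F ≃+* F) : Subfield F where
  carrier := {x | σ x = x}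
  mul_mem' := by
    intro a b ha hb
    simp only [Set.mem_setOf_eq] at *
    rw [map_mul, ha, hb]
  one_mem' := by simp only [Set.mem_setOf_eq, map_one]
  add_mem' := by
    intro a b ha hb
    simp only [Set.mem_setOf_eq] at *
    rw [map_add, ha, hb]
  zero_mem' := by simp only [Set.mem_setOf_eq, map_zero]
  neg_mem' := by
    intro a ha
    simp only [Set.mem_setOf_eq] at *
    rw [map_neg, ha]
  inv_mem' := by
    intro a ha
    simp only [Set.mem_setOf_eq] at *
    rw [map_inv₀, ha]

/-- The code `C_(θ,h,T)` over a field `L`. -/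
def code {L : Type*} [Field L] {ι : Type*} [Fintype ι] (θ : L ≃+* L) (h : ι → L)
    (T : Set ℤ) : Set (ι → L) :=
  {v : ι → L | ∀ i ∈ T, ∑ j, v j * (θ ^ i) (h j) = 0}

/-- If `σ` has order `m` and `θ` extends `σ`, then `θ ^ (m * k)` fixes the image of the base
field. -/
theorem zpow_mul_orderOf_algebraMap {F L : Type*} [Field F] [Field L] [Algebra F L]
    {σ : F ≃+* F} {θ : L ≃+* L}
    (hres : ∀ x : F, θ (algebraMap F L x) = algebraMap F L (σ x)) (k : ℤ) (x : F) :
    (θ ^ ((orderOf σ : ℤ) * k)) (algebraMap F L x) = algebraMap F L x := by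
  have hpow : ∀ (d : ℕ) (y : F), (θ ^ d) (algebraMap F L y) = algebraMap F L ((σ ^ d) y) := by
    intro d
    induction d with
    | zero => intro y; rfl
    | succ d ih => intro y; rw [pow_succ, pow_succ, RingAut.mul_apply, RingAut.mul_apply, hres, ih]
  have hfixed : θ ^ orderOf σ ∈ MulAction.stabilizer (L ≃+* L) (algebraMap F L x) := by
    rw [MulAction.mem_stabilizer_iff, RingAut.smul_def, hpow, pow_orderOf_eq_one]
    rfl
  rw [zpow_mul, zpow_natCast]
  exact Subgroup.zpow_mem _ hfixed k

/-- If every exponent in `T` is congruent to one in `S` modulo the order of `σ`, then the subfield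
subcode for `S` is contained in the one for `T`. -/
theorem algebraMap_mem_code_of_image_subset {F L : Type*} [Field F] [Field L] [Algebra F L]
    {σ : F ≃+* F} {θ : L ≃+* L}
    (hres : ∀ x : F, θ (algebraMap F L x) = algebraMap F L (σ x)) {S T : Set ℤ}
    (hST : (fun x : ℤ => (x : ZMod (orderOf σ))) '' T ⊆
      (fun x : ℤ => (x : ZMod (orderOf σ))) '' S)
    {ι : Type*} [Fintype ι] {h : ι → L} {c : ι → F}
    (hc : (fun j => algebraMap F L (c j)) ∈ code θ h S) :
    (fun j => algebraMap F L (c j)) ∈ code θ h T := by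
  intro i hi
  obtain ⟨s, hs, hsi⟩ := hST ⟨i, hi, rfl⟩
  obtain ⟨k, hk⟩ := (ZMod.intCast_eq_intCast_iff_dvd_sub s i _).1 hsi
  obtain rfl : i = (orderOf σ : ℤ) * k + s := by lia
  have key := congrArg (θ ^ ((orderOf σ : ℤ) * k)) (hc s hs)
  simpa only [map_sum, map_mul, map_zero, zpow_mul_orderOf_algebraMap hres, zpow_add,
    RingAut.mul_apply] using key

/-- If `T₁` and `T₂` have the same elements modulo `m` (the order of `σ`), then the
corresponding subfield subcodes with respect to `F` coincide. -/
theorem subfield_subcode_mod_invariance {F L : Type*} [Field F] [Field L] [Algebra F L]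
    [FiniteDimensional F L]
    (σ : F ≃+* F) (m : ℕ) (hm0 : 0 < m) (hord : orderOf σ = m)
    (θ : L ≃+* L)
    (hres : ∀ x : F, θ (algebraMap F L x) = algebraMap F L (σ x))
    (hfix : ∀ y : L, θ y = y ↔ ∃ x : F, σ x = x ∧ algebraMap F L x = y)
    (T₁ T₂ : Set ℤ)
    (hT : (fun x : ℤ => (x : ZMod m)) '' T₁ = (fun x : ℤ => (x : ZMod m)) '' T₂)
    {n : ℕ} (h : Fin n → L) (hh : LinearIndependent (fixedField θ) h)
    (c : Fin n → F) :
    (fun j => algebraMap F L (c j)) ∈ code θ h T₁ ↔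
      (fun j => algebraMap F L (c j)) ∈ code θ h T₂ := by
  subst hord
  exact ⟨algebraMap_mem_code_of_image_subset hres hT.ge,
    algebraMap_mem_code_of_image_subset hres hT.le⟩
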